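/- arXiv:1307.3583 — 2 statements merged into one kernel-verified Lean document; each statement's English description precedes it below -/
import Mathlib

section
/- With (αₙ)ₙ≥₁ the increasing enumeration of the absolute values of the zeros of Ai, one has αₙ^{3/2}/n → 3π/2 as n → ∞ (equivalently, αₙ·n^{−2/3} → (3π/2)^{2/3}). -/
open MeasureTheory Filter Set

/-- The Airy function of the first kind, defined as
`Ai(x) = (1/π) · lim_{R→∞} ∫₀^R cos(t³/3 + x·t) dt`. -/
noncomputable def Ai (x : ℝ) : ℝ :=
  (1 / Real.pi) *
    limUnder Filter.atTop (fun R : ℝ => ∫ t in (0:ℝ)..R, Real.cos (t ^ 3 / 3 + x * t))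

noncomputable def AE (x : ℝ) (z : ℂ) : ℂ := Complex.exp (Complex.I * (z ^ 3 / 3 + x * z))

lemma AE_re (x t y : ℝ) : (Complex.I * (((t:ℂ) + y * Complex.I) ^ 3 / 3 +
    x * ((t:ℂ) + y * Complex.I))).re = -(t ^ 2 * y - y ^ 3 / 3 + x * y) := by
  have : (Complex.I * (((t:ℂ) + y * Complex.I) ^ 3 / 3 + x * ((t:ℂ) + y * Complex.I)))
     = ((-(t ^ 2 * y - y ^ 3 / 3 + x * y) : ℝ) : ℂ) +
        ((t ^ 3 / 3 - t * y ^ 2 + x * t : ℝ) : ℂ) * Complex.I := by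
    have h2 : Complex.I ^ 2 = -1 := Complex.I_sq
    have h3 : Complex.I ^ 3 = -Complex.I := by rw [pow_succ, h2]; ring
    have h4 : Complex.I ^ 4 = 1 := Complex.I_pow_four
    push_cast
    ring_nf
    rw [h2, h3, h4]
    ring
  rw [this, Complex.add_re, Complex.re_ofReal_mul, Complex.I_re, Complex.ofReal_re]
  ring

lemma AE_norm (x t y : ℝ) : ‖AE x ((t:ℂ) + y * Complex.I)‖ =
    Real.exp (-(t ^ 2 * y - y ^ 3 / 3 + x * y)) := by
  rw [AE, Complex.norm_exp, AE_re]

lemma AE_norm1 (x t : ℝ) : ‖AE x ((t:ℂ) + Complex.I)‖ = Real.exp (-t ^ 2 + 1 / 3 - x) := by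
  have := AE_norm x t 1
  simp only [Complex.ofReal_one, one_mul] at this
  rw [this]
  congr 1
  ring

lemma AE_bound (k : ℕ) (x₀ x t : ℝ) (ht : 0 < t) (hx : x₀ - 1 < x) :
    ‖(Complex.I * ((t:ℂ) + Complex.I)) ^ k * AE x ((t:ℂ) + Complex.I)‖ ≤
      Real.exp ((k:ℝ) ^ 2 / 2 + 1 / 3 - x₀ + 1) * Real.exp (-(1/2) * t ^ 2) := by
  rw [norm_mul, AE_norm1, norm_pow, norm_mul, Complex.norm_I, one_mul]
  have h1 : ‖(t:ℂ) + Complex.I‖ ≤ Real.exp t := by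
    refine (norm_add_le _ _).trans ?_
    rw [Complex.norm_I, Complex.norm_real, Real.norm_of_nonneg ht.le]
    exact Real.add_one_le_exp t
  calc ‖(t:ℂ) + Complex.I‖ ^ k * Real.exp (-t ^ 2 + 1 / 3 - x)
      ≤ Real.exp t ^ k * Real.exp (-t ^ 2 + 1 / 3 - x) := by gcongr
    _ = Real.exp (k * t + (-t ^ 2 + 1 / 3 - x)) := by rw [Real.exp_add, Real.exp_nat_mul]
    _ ≤ Real.exp (((k:ℝ) ^ 2 / 2 + 1 / 3 - x₀ + 1) + (-(1/2) * t ^ 2)) := by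
        apply Real.exp_le_exp.2
        nlinarith [sq_nonneg ((k:ℝ) - t)]
    _ = _ := Real.exp_add _ _

lemma AE_cont (k : ℕ) (x : ℝ) : Continuous
    (fun t : ℝ => (Complex.I * ((t:ℂ) + Complex.I)) ^ k * AE x ((t:ℂ) + Complex.I)) := by
  unfold AE; fun_prop

lemma AE_int_bound (k : ℕ) (x₀ : ℝ) : Integrable (fun t : ℝ =>
    Real.exp ((k:ℝ) ^ 2 / 2 + 1 / 3 - x₀ + 1) * Real.exp (-(1/2) * t ^ 2))
      (volume.restrict (Ioi 0)) :=
  ((integrable_exp_neg_mul_sq (by norm_num)).const_mul _).integrableOn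

lemma AE_int (k : ℕ) (x : ℝ) : Integrable
    (fun t : ℝ => (Complex.I * ((t:ℂ) + Complex.I)) ^ k * AE x ((t:ℂ) + Complex.I))
      (volume.restrict (Ioi 0)) := by
  refine (AE_int_bound k x).mono' (AE_cont k x).aestronglyMeasurable ?_
  filter_upwards [ae_restrict_mem measurableSet_Ioi] with t ht
  exact AE_bound k x x t ht (by linarith)

noncomputable def AF (k : ℕ) (x : ℝ) : ℂ :=
  ∫ t in Ioi (0:ℝ), (Complex.I * ((t:ℂ) + Complex.I)) ^ k * AE x ((t:ℂ) + Complex.I)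

lemma AF_deriv (k : ℕ) (x : ℝ) : HasDerivAt (AF k) (AF (k+1) x) x := by
  refine (hasDerivAt_integral_of_dominated_loc_of_deriv_le
    (F := fun (x : ℝ) (t : ℝ) => (Complex.I * ((t:ℂ) + Complex.I)) ^ k * AE x ((t:ℂ) + Complex.I))
    (F' := fun (x : ℝ) (t : ℝ) =>
      (Complex.I * ((t:ℂ) + Complex.I)) ^ (k+1) * AE x ((t:ℂ) + Complex.I))
    (μ := volume.restrict (Ioi 0)) (s := Ioi (x - 1)) (Ioi_mem_nhds (by linarith))
    (Eventually.of_forall fun x => (AE_cont k x).aestronglyMeasurable) (AE_int k x)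
    (AE_cont (k+1) x).aestronglyMeasurable ?_ (AE_int_bound (k+1) x) ?_).2
  · filter_upwards [ae_restrict_mem measurableSet_Ioi] with t ht
    intro u hu
    exact AE_bound (k+1) x u t ht hu
  · refine Eventually.of_forall fun t => ?_
    intro u _
    have h0 : HasDerivAt (fun u : ℝ => (u:ℂ)) 1 u := Complex.ofRealCLM.hasDerivAt
    have h1 := ((((h0.mul_const ((t:ℂ) + Complex.I)).const_add
      (((t:ℂ) + Complex.I) ^ 3 / 3)).const_mul Complex.I).cexp).const_mul
        ((Complex.I * ((t:ℂ) + Complex.I)) ^ k)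
    refine h1.congr_deriv ?_
    unfold AE
    ring

lemma AE_tendsto (x : ℝ) : Tendsto (fun t : ℝ => AE x ((t:ℂ) + Complex.I)) atTop (nhds 0) := by
  rw [tendsto_zero_iff_norm_tendsto_zero]
  simp only [AE_norm1]
  apply Real.tendsto_exp_atBot.comp
  have : Tendsto (fun t : ℝ => t ^ 2) atTop atTop := tendsto_pow_atTop (by norm_num)
  have := (tendsto_neg_atTop_atBot.comp this).atBot_add (tendsto_const_nhds (x := 1/3 - x))
  refine this.congr fun t => ?_
  simp only [Function.comp]
  ring

lemma AF_ode (x : ℝ) : (AF 2 x).re = x * (AF 0 x).re := by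
  have hd : ∀ t ∈ Ici (0:ℝ), HasDerivAt (fun t : ℝ => Complex.I * AE x ((t:ℂ) + Complex.I))
      ((Complex.I * ((t:ℂ) + Complex.I)) ^ 2 * AE x ((t:ℂ) + Complex.I) -
        x * ((Complex.I * ((t:ℂ) + Complex.I)) ^ 0 * AE x ((t:ℂ) + Complex.I))) t := by
    intro t _
    have h0 : HasDerivAt (fun u : ℝ => (u:ℂ) + Complex.I) 1 t :=
      (Complex.ofRealCLM.hasDerivAt (x := t)).add_const _
    have h1 := (((((h0.pow 3).div_const 3).add (h0.const_mul (x:ℂ))).const_mul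
      Complex.I).cexp).const_mul Complex.I
    refine h1.congr_deriv ?_
    have h2 : Complex.I ^ 2 = -1 := Complex.I_sq
    simp only [AE, Pi.add_apply, Pi.pow_apply]
    rw [mul_pow, h2]
    push_cast
    linear_combination ((((t:ℂ) + Complex.I) ^ 2 + x) * 
      Complex.exp (Complex.I * (((t:ℂ) + Complex.I) ^ 3 / 3 + x * ((t:ℂ) + Complex.I)))) * h2
  have hlim := (AE_tendsto x).const_mul Complex.I
  rw [mul_zero] at hlim
  have hint := (AE_int 2 x).sub ((AE_int 0 x).const_mul (x:ℂ))
  have := integral_Ioi_of_hasDerivAt_of_tendsto' hd hint hlim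
  rw [integral_sub (AE_int 2 x) ((AE_int 0 x).const_mul (x:ℂ)), integral_const_mul] at this
  change AF 2 x - x * AF 0 x = _ at this
  have h := congrArg Complex.re this
  have hr : AE x (((0:ℝ):ℂ) + Complex.I) = ((Real.exp (1/3 - x) : ℝ) : ℂ) := by
    rw [AE, Complex.ofReal_exp]
    congr 1
    have h2 : Complex.I ^ 2 = -1 := Complex.I_sq
    have h4 : Complex.I ^ 4 = 1 := Complex.I_pow_four
    push_cast
    ring_nf
    rw [h2, h4]
    ring
  rw [hr] at h
  simp [-Complex.ofReal_exp] at h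
  linarith

lemma Ai_eq (x : ℝ) : Ai x = 1 / Real.pi * (AF 0 x).re := by
  unfold Ai
  congr 1
  apply Tendsto.limUnder_eq
  have hrect : ∀ R : ℝ, ∫ t in (0:ℝ)..R, Real.cos (t ^ 3 / 3 + x * t) =
      ((∫ t in (0:ℝ)..R, (Complex.I * ((t:ℂ) + Complex.I)) ^ 0 * AE x ((t:ℂ) + Complex.I)) -
       Complex.I * ∫ y in (0:ℝ)..1, AE x ((R:ℂ) + y * Complex.I)).re := by
    intro R
    have h := Complex.integral_boundary_rect_eq_zero_of_differentiableOn (AE x) 0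
      (⟨R, 1⟩ : ℂ) (by unfold AE; fun_prop)
    simp only [Complex.zero_re, Complex.zero_im, smul_eq_mul, Complex.ofReal_zero, zero_mul,
      add_zero, Complex.ofReal_one, one_mul, zero_add] at h
    have hv : ∫ y in (0:ℝ)..1, AE x (y * Complex.I) =
        ((∫ y in (0:ℝ)..1, Real.exp (y ^ 3 / 3 - x * y) : ℝ) : ℂ) := by
      rw [← intervalIntegral.integral_ofReal]
      congr 1
      ext y
      rw [AE, Complex.ofReal_exp]
      congr 1
      have h2 : Complex.I ^ 2 = -1 := Complex.I_sq
      have h4 : Complex.I ^ 4 = 1 := Complex.I_pow_four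
      push_cast
      ring_nf
      rw [h2, h4]
      ring
    have hb : (∫ t in (0:ℝ)..R, AE x t).re = ∫ t in (0:ℝ)..R, Real.cos (t ^ 3 / 3 + x * t) := by
      have hi : IntervalIntegrable (fun t : ℝ => AE x t) volume 0 R :=
        Continuous.intervalIntegrable (by unfold AE; fun_prop) _ _
      have := Complex.reCLM.intervalIntegral_comp_comm hi
      simp only [Complex.reCLM_apply] at this
      rw [← this]
      congr 1
      ext t
      rw [AE, ← Complex.exp_ofReal_mul_I_re]
      congr 2
      push_cast
      ring
    rw [hv] at h
    have h' := congrArg Complex.re h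
    simp only [Complex.sub_re, Complex.add_re, Complex.I_mul_re, Complex.ofReal_im, 
      Complex.zero_re, hb] at h'
    simp only [pow_zero, one_mul, Complex.sub_re, Complex.I_mul_re]
    linarith
  simp only [hrect]
  have h1 := intervalIntegral_tendsto_integral_Ioi (0:ℝ) (AE_int 0 x) tendsto_id
  have h2 : Tendsto (fun R : ℝ => ∫ y in (0:ℝ)..1, AE x ((R:ℂ) + y * Complex.I)) atTop
      (nhds (∫ y in (0:ℝ)..1, (0:ℂ))) := by
    apply intervalIntegral.tendsto_integral_filter_of_dominated_convergence
      (fun _ => Real.exp (1 / 3 + |x|))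
    · exact Eventually.of_forall fun R =>
        Continuous.aestronglyMeasurable (by unfold AE; fun_prop)
    · refine Eventually.of_forall fun R => Eventually.of_forall fun y hy => ?_
      rw [uIoc_of_le zero_le_one] at hy
      rw [AE_norm]
      apply Real.exp_le_exp.2
      have a1 : 0 ≤ R ^ 2 * y := mul_nonneg (sq_nonneg _) hy.1.le
      have a2 : y ^ 3 ≤ 1 := pow_le_one₀ hy.1.le hy.2
      have a3 : -(x * y) ≤ |x| := by
        calc -(x * y) ≤ |x * y| := neg_le_abs _
          _ = |x| * y := by rw [abs_mul, abs_of_pos hy.1]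
          _ ≤ |x| * 1 := by gcongr; exact hy.2
          _ = |x| := mul_one _
      linarith
    · exact intervalIntegrable_const
    · refine Eventually.of_forall fun y hy => ?_
      rw [uIoc_of_le zero_le_one] at hy
      rw [tendsto_zero_iff_norm_tendsto_zero]
      simp only [AE_norm]
      apply Real.tendsto_exp_atBot.comp
      have : Tendsto (fun t : ℝ => t ^ 2) atTop atTop := tendsto_pow_atTop (by norm_num)
      have := (tendsto_neg_atTop_atBot.comp (this.atTop_mul_const hy.1)).atBot_add
        (tendsto_const_nhds (x := y ^ 3 / 3 - x * y))
      refine this.congr fun t => ?_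
      simp only [Function.comp]
      ring
  rw [intervalIntegral.integral_zero] at h2
  have h3 := h1.sub (h2.const_mul Complex.I)
  rw [mul_zero, sub_zero] at h3
  exact (Complex.continuous_re.tendsto _).comp h3


lemma sturm_upper (y y' : ℝ → ℝ) (h1 : ∀ s, HasDerivAt y (y' s) s)
    (h2 : ∀ s, HasDerivAt y' (-s * y s) s) (a b : ℝ) (ha : 0 < a) (hab : a < b)
    (hya : y a = 0) (hp : ∀ s ∈ Ioo a b, 0 < y s) : b - a ≤ Real.pi / Real.sqrt a := by
  by_contra hcon
  push Not at hcon
  set k := Real.sqrt a with hk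
  have hkpos : 0 < k := Real.sqrt_pos.2 ha
  have hk2 : k * k = a := Real.mul_self_sqrt ha.le
  have hπ := Real.pi_pos
  set c := a + Real.pi / k with hc
  have hq : 0 < Real.pi / k := by positivity
  have hac : a < c := by linarith
  have hcb : c < b := by linarith
  have hlin : ∀ s, HasDerivAt (fun s => k * (s - a)) k s := fun s => by
    simpa using ((hasDerivAt_id s).sub_const a).const_mul k
  let W : ℝ → ℝ := fun s => y s * (Real.cos (k * (s - a)) * k) - y' s * Real.sin (k * (s - a))
  have hW : ∀ s, HasDerivAt W ((s - a) * y s * Real.sin (k * (s - a))) s := fun s => by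
    have := ((h1 s).mul ((hlin s).cos.mul_const k)).sub ((h2 s).mul (hlin s).sin)
    refine this.congr_deriv ?_
    linear_combination (-(y s * Real.sin (k * (s - a)))) * hk2
  have hmon : MonotoneOn W (Icc a c) := by
    apply monotoneOn_of_deriv_nonneg (convex_Icc a c)
      (fun s _ => (hW s).continuousAt.continuousWithinAt)
      (fun s _ => (hW s).differentiableAt.differentiableWithinAt)
    intro s hs
    rw [interior_Icc] at hs
    rw [(hW s).deriv]
    have e : k * (s - a) ≤ Real.pi := by
      have : s - a ≤ Real.pi / k := by have := hs.2; linarith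
      calc k * (s - a) ≤ k * (Real.pi / k) := by gcongr
        _ = Real.pi := by field_simp
    have := Real.sin_nonneg_of_nonneg_of_le_pi
      (mul_nonneg hkpos.le (sub_nonneg.2 hs.1.le)) e
    have h3 := hp s ⟨hs.1, hs.2.trans hcb⟩
    have h4 : 0 ≤ s - a := sub_nonneg.2 hs.1.le
    positivity
  have := hmon (left_mem_Icc.2 hac.le) (right_mem_Icc.2 hac.le) hac.le
  have e : k * (c - a) = Real.pi := by rw [hc]; field_simp; ring
  simp only [W, e, hya] at this
  simp at this
  have h3 := hp c ⟨hac, hcb⟩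
  nlinarith [mul_pos h3 hkpos]

lemma sturm_lower (y y' : ℝ → ℝ) (h1 : ∀ s, HasDerivAt y (y' s) s)
    (h2 : ∀ s, HasDerivAt y' (-s * y s) s) (a b : ℝ) (ha : 0 < a) (hab : a < b)
    (hya : y a = 0) (hyb : y b = 0)
    (hp : ∀ s ∈ Ioo a b, 0 < y s) : Real.pi / Real.sqrt b ≤ b - a := by
  by_contra hcon
  push Not at hcon
  set k := Real.sqrt b with hk
  have hb : 0 < b := ha.trans hab
  have hkpos : 0 < k := Real.sqrt_pos.2 hb
  have hk2 : k * k = b := Real.mul_self_sqrt hb.le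
  have hπ := Real.pi_pos
  have hlin : ∀ s, HasDerivAt (fun s => k * (s - a)) k s := fun s => by
    simpa using ((hasDerivAt_id s).sub_const a).const_mul k
  let W : ℝ → ℝ := fun s => y s * (Real.cos (k * (s - a)) * k) - y' s * Real.sin (k * (s - a))
  have hW : ∀ s, HasDerivAt W ((s - b) * y s * Real.sin (k * (s - a))) s := fun s => by
    have := ((h1 s).mul ((hlin s).cos.mul_const k)).sub ((h2 s).mul (hlin s).sin)
    refine this.congr_deriv ?_
    linear_combination (-(y s * Real.sin (k * (s - a)))) * hk2
  have hsin : ∀ s, a < s → s ≤ b → 0 < Real.sin (k * (s - a)) := by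
    intro s h h'
    apply Real.sin_pos_of_pos_of_lt_pi (mul_pos hkpos (sub_pos.2 h))
    calc k * (s - a) < k * (Real.pi / k) := by gcongr; linarith
        _ = Real.pi := by field_simp
  have hmon : StrictAntiOn W (Icc a b) := by
    apply strictAntiOn_of_deriv_neg (convex_Icc a b)
      (fun s _ => (hW s).continuousAt.continuousWithinAt)
    intro s hs
    rw [interior_Icc] at hs
    rw [(hW s).deriv]
    have := hsin s hs.1 hs.2.le
    have h3 := hp s hs
    have h4 : 0 < b - s := sub_pos.2 hs.2
    have : 0 < (b - s) * y s * Real.sin (k * (s - a)) := by positivity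
    linarith
  have := hmon (left_mem_Icc.2 hab.le) (right_mem_Icc.2 hab.le) hab
  have hs := hsin b hab le_rfl
  simp only [W, hya, hyb] at this
  simp at this
  have hy' : 0 < y' b := by
    by_contra h
    push Not at h
    nlinarith
  -- contradiction: y has positive derivative at b, so y negative to the left
  have hsl := (hasDerivAt_iff_tendsto_slope.1 (h1 b)).eventually (lt_mem_nhds hy')
  have hsl' : ∀ᶠ s in nhdsWithin b (Iio b), 0 < slope y b s :=
    hsl.filter_mono (nhdsWithin_mono _ (fun s hs => ne_of_lt hs))
  obtain ⟨s, hs1, hs2⟩ := (hsl'.and (Ioo_mem_nhdsLT hab)).exists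
  rw [slope_def_field, hyb] at hs1
  have h3 := hp s hs2
  have h4 : s - b < 0 := by linarith [hs2.2]
  have := div_neg_of_pos_of_neg h3 h4
  simp at hs1
  linarith

lemma sturm_both (y y' : ℝ → ℝ) (h1 : ∀ s, HasDerivAt y (y' s) s)
    (h2 : ∀ s, HasDerivAt y' (-s * y s) s) (a b : ℝ) (ha : 0 < a) (hab : a < b)
    (hya : y a = 0) (hyb : y b = 0)
    (hp : ∀ s ∈ Ioo a b, y s ≠ 0) :
    Real.pi / Real.sqrt b ≤ b - a ∧ b - a ≤ Real.pi / Real.sqrt a := by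
  have hc : ContinuousOn y (Ioo a b) := fun s _ => (h1 s).continuousAt.continuousWithinAt
  have hdich : (∀ s ∈ Ioo a b, 0 < y s) ∨ (∀ s ∈ Ioo a b, 0 < - y s) := by
    by_contra h
    push Not at h
    obtain ⟨⟨s, hs, hs'⟩, t, ht, ht'⟩ := h
    have hI := isPreconnected_Ioo.intermediate_value hs ht hc
    obtain ⟨u, hu, hu'⟩ := hI ⟨hs', by linarith⟩
    exact hp u hu hu'
  rcases hdich with h | h
  · exact ⟨sturm_lower y y' h1 h2 a b ha hab hya hyb h, sturm_upper y y' h1 h2 a b ha hab hya h⟩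
  · have h1' : ∀ s, HasDerivAt (fun s => - y s) (- y' s) s := fun s => (h1 s).neg
    have h2' : ∀ s, HasDerivAt (fun s => - y' s) (-s * -y s) s := fun s => by
      refine (h2 s).neg.congr_deriv ?_
      ring
    exact ⟨sturm_lower (fun s => - y s) (fun s => - y' s) h1' h2' a b ha hab (by simp [hya]) (by simp [hyb]) h,
      sturm_upper (fun s => - y s) (fun s => - y' s) h1' h2' a b ha hab (by simp [hya]) h⟩

lemma seq_asymp (α : ℕ → ℝ)
    (hpos : ∀ n : ℕ, 1 ≤ n → 0 < α n)
    (hmono : ∀ m n : ℕ, 1 ≤ m → m < n → α m < α n)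
    (hgap : ∀ n : ℕ, 1 ≤ n → Real.pi / Real.sqrt (α (n+1)) ≤ α (n+1) - α n ∧
      α (n+1) - α n ≤ Real.pi / Real.sqrt (α n)) :
    Filter.Tendsto (fun n : ℕ => (α n) ^ ((3:ℝ)/2) / (n : ℝ)) Filter.atTop
      (nhds (3 * Real.pi / 2)) := by
  have hπ := Real.pi_pos
  have hinf : Tendsto α atTop atTop := by
    rw [← tendsto_add_atTop_iff_nat 1]
    apply tendsto_atTop_atTop_of_monotone
    · exact monotone_nat_of_le_succ fun n => (hmono _ _ (by omega) (by omega)).le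
    by_contra hB
    push Not at hB
    obtain ⟨B, hB⟩ := hB
    have hB0 : 0 < B := (hpos 1 le_rfl).trans (hB 0)
    have hs : 0 < Real.sqrt B := Real.sqrt_pos.2 hB0
    have hlow : ∀ n : ℕ, n * (Real.pi / Real.sqrt B) ≤ α (n + 1) := by
      intro n
      induction n with
      | zero => simpa using (hpos 1 le_rfl).le
      | succ n ih =>
        have h := (hgap (n+1) (by omega)).1
        have h3 : 0 < Real.sqrt (α (n+1+1)) := Real.sqrt_pos.2 (hpos _ (by omega))
        have : Real.pi / Real.sqrt B ≤ Real.pi / Real.sqrt (α (n+1+1)) := by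
          gcongr
          exact (hB (n+1)).le
        push_cast
        linarith
    obtain ⟨n, hn⟩ := exists_nat_gt (B / (Real.pi / Real.sqrt B))
    rw [div_lt_iff₀ (by positivity)] at hn
    linarith [hlow n, hB n]
  set x : ℕ → ℝ := fun n => Real.sqrt (α n) with hx
  have hxinf : Tendsto x atTop atTop := Real.tendsto_sqrt_atTop.comp hinf
  have hxpos : ∀ n, 1 ≤ n → 0 < x n := fun n hn => Real.sqrt_pos.2 (hpos n hn)
  have hxsq : ∀ n, 1 ≤ n → x n ^ 2 = α n := fun n hn => Real.sq_sqrt (hpos n hn).le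
  have hxle : ∀ n, 1 ≤ n → x n ≤ x (n+1) := fun n hn =>
    Real.sqrt_le_sqrt (hmono n (n+1) hn (by omega)).le
  have hr : Tendsto (fun n => x (n+1) / x n) atTop (nhds 1) := by
    have hup : Tendsto (fun n => 1 + Real.pi / x n ^ 3) atTop (nhds 1) := by
      have : Tendsto (fun n => Real.pi / x n ^ 3) atTop (nhds 0) :=
        Tendsto.const_div_atTop ((tendsto_pow_atTop (by norm_num)).comp hxinf) _
      simpa using this.const_add 1
    refine tendsto_of_tendsto_of_tendsto_of_le_of_le' tendsto_const_nhds hup ?_ ?_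
    · filter_upwards [eventually_ge_atTop 1] with n hn
      rw [le_div_iff₀ (hxpos n hn)]
      linarith [hxle n hn]
    · filter_upwards [eventually_ge_atTop 1] with n hn
      have h := (hgap n hn).2
      rw [← hxsq n hn, ← hxsq (n+1) (by omega)] at h
      have hp := hxpos n hn
      rw [show Real.sqrt (x n ^ 2) = x n from Real.sqrt_sq hp.le] at h
      have hle := hxle n hn
      have h1 : 1 ≤ x (n+1) / x n := by rw [le_div_iff₀ hp]; linarith
      calc x (n+1) / x n ≤ (x (n+1) / x n)^2 := by nlinarith
        _ = 1 + (x (n+1) ^ 2 - x n ^ 2) / x n ^ 2 := by field_simp; ring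
        _ ≤ 1 + (Real.pi / x n) / x n ^ 2 := by gcongr
        _ = _ := by field_simp
  have hd : Tendsto (fun n => x (n+1) ^ 3 - x n ^ 3) atTop (nhds (3 * Real.pi / 2)) := by
    have hup : Tendsto (fun n => (3 * Real.pi / 2) * (x (n+1) / x n)) atTop
        (nhds (3 * Real.pi / 2)) := by simpa using hr.const_mul (3 * Real.pi / 2)
    have hlo : Tendsto (fun n => (3 * Real.pi / 2) * (x (n+1) / x n)⁻¹) atTop
        (nhds (3 * Real.pi / 2)) := by
      simpa using (hr.inv₀ one_ne_zero).const_mul (3 * Real.pi / 2)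
    refine tendsto_of_tendsto_of_tendsto_of_le_of_le' hlo hup ?_ ?_
    · filter_upwards [eventually_ge_atTop 1] with n hn
      have h := (hgap n hn).1
      have hp := hxpos n hn
      have hle := hxle n hn
      have hp' := hxpos (n+1) (by omega)
      rw [← hxsq n hn, ← hxsq (n+1) (by omega), Real.sqrt_sq hp'.le] at h
      calc 3 * Real.pi / 2 * (x (n+1) / x n)⁻¹ = (3 / 2 * x n) * (Real.pi / x (n+1)) := by
            field_simp
        _ ≤ (3 / 2 * x n) * (x (n+1) ^ 2 - x n ^ 2) := by gcongr
        _ ≤ _ := by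
          nlinarith [mul_nonneg (sq_nonneg (x (n+1) - x n)) (by linarith : 0 ≤ 2 * x (n+1) + x n)]
    · filter_upwards [eventually_ge_atTop 1] with n hn
      have h := (hgap n hn).2
      have hp := hxpos n hn
      have hle := hxle n hn
      have hp' := hxpos (n+1) (by omega)
      rw [← hxsq n hn, ← hxsq (n+1) (by omega), Real.sqrt_sq hp.le] at h
      calc x (n+1) ^ 3 - x n ^ 3 ≤ (3 / 2 * x (n+1)) * (x (n+1) ^ 2 - x n ^ 2) := by
            nlinarith [mul_nonneg (sq_nonneg (x (n+1) - x n)) (by linarith : 0 ≤ x (n+1) + 2 * x n)]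
        _ ≤ (3 / 2 * x (n+1)) * (Real.pi / x n) := by gcongr
        _ = _ := by field_simp
  have hces := hd.cesaro
  have hsum : ∀ n, ∑ i ∈ Finset.range n, (x (i+1) ^ 3 - x i ^ 3) = x n ^ 3 - x 0 ^ 3 := fun n =>
    Finset.sum_range_sub (fun i => x i ^ 3) n
  simp only [hsum] at hces
  have hz : Tendsto (fun n : ℕ => x 0 ^ 3 / (n:ℝ)) atTop (nhds 0) :=
    tendsto_const_div_atTop_nhds_zero_nat _
  have hfin := hces.add hz
  rw [add_zero] at hfin
  refine hfin.congr' ?_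
  filter_upwards [eventually_ge_atTop 1] with n hn
  have h32 : α n ^ ((3:ℝ)/2) = x n ^ 3 := by
    rw [← hxsq n hn, ← Real.rpow_natCast, ← Real.rpow_mul (hxpos n hn).le, ← Real.rpow_natCast]
    norm_num
  rw [h32]
  ring

theorem airy_zeros_asymptotics (α : ℕ → ℝ)
    (hpos : ∀ n : ℕ, 1 ≤ n → 0 < α n)
    (hmono : ∀ m n : ℕ, 1 ≤ m → m < n → α m < α n)
    (hzero : ∀ n : ℕ, 1 ≤ n → Ai (-(α n)) = 0)
    (hall : ∀ x : ℝ, Ai x = 0 → ∃ n : ℕ, 1 ≤ n ∧ x = -(α n)) :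
    Filter.Tendsto (fun n : ℕ => (α n) ^ ((3:ℝ)/2) / (n : ℝ)) Filter.atTop
      (nhds (3 * Real.pi / 2)) := by
  apply seq_asymp α hpos hmono
  intro n hn
  have hre : ∀ k s, HasDerivAt (fun s : ℝ => (AF k (-s)).re) (-(AF (k+1) (-s)).re) s := by
    intro k s
    have h1 := (AF_deriv k (-s)).scomp s (hasDerivAt_neg s)
    have h2 := Complex.reCLM.hasFDerivAt.comp_hasDerivAt s h1
    refine h2.congr_deriv ?_
    simp
  have hz : ∀ s, Ai (-s) = 0 ↔ (AF 0 (-s)).re = 0 := by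
    intro s
    rw [Ai_eq]
    simp [Real.pi_ne_zero]
  apply sturm_both (fun s => (AF 0 (-s)).re) (fun s => -(AF 1 (-s)).re) (hre 0)
    _ (α n) (α (n+1)) (hpos n hn) (hmono _ _ hn (by omega))
    ((hz _).1 (hzero n hn)) ((hz _).1 (hzero _ (by omega)))
  · intro s hs h0
    obtain ⟨m, hm, hm'⟩ := hall (-s) ((hz s).2 h0)
    have hsm : s = α m := by linarith
    rw [hsm] at hs
    rcases lt_trichotomy m n with h | h | h
    · exact absurd (hmono m n hm h) (not_lt.2 hs.1.le)
    · rw [h] at hs; exact lt_irrefl _ hs.1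
    · rcases eq_or_lt_of_le (Nat.succ_le_of_lt h) with h' | h'
      · rw [← h'] at hs; exact lt_irrefl _ hs.2
      · exact absurd (hmono (n+1) m (by omega) h') (not_lt.2 hs.2.le)
  · intro s
    refine (hre 1 s).neg.congr_deriv ?_
    rw [AF_ode]
    ring
end

section
/- If a and b are two distinct zeros of Ai (Ai(a) = Ai(b) = 0, a ≠ b, a, b < 0), then the translates Ai(· + a) and Ai(· + b) are orthogonal in L²(0,∞): ∫₀^∞ Ai(x + a)·Ai(x + b) dx = 0. -/
open MeasureTheory Filter Set

open Topology

noncomputable def airyG (x : ℝ) (z : ℂ) : ℂ :=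
  Complex.exp (Complex.I * (z ^ 3 / 3 + x * z))

noncomputable def airyF (k : ℕ) (x : ℝ) : ℂ :=
  ∫ t : ℝ, ((t : ℂ) + Complex.I) ^ k * airyG x ((t : ℂ) + Complex.I)

lemma airyG_norm (x r y : ℝ) :
    ‖airyG x ((r : ℂ) + y * Complex.I)‖ = Real.exp (- r ^ 2 * y + y ^ 3 / 3 - x * y) := by
  rw [airyG, Complex.norm_exp]
  congr 1
  have : Complex.I * (((r : ℂ) + y * Complex.I) ^ 3 / 3 + x * ((r : ℂ) + y * Complex.I))
      = ((- r ^ 2 * y + y ^ 3 / 3 - x * y : ℝ) : ℂ)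
        + ((r ^ 3 / 3 - r * y ^ 2 + x * r : ℝ) : ℂ) * Complex.I := by
    push_cast
    linear_combination ((r:ℂ) ^ 2 * y + x * y + y ^ 3 / 3 * (Complex.I ^ 2 - 1) + r * y ^ 2 * Complex.I) * Complex.I_sq
  rw [this]
  simp only [Complex.add_re, Complex.re_ofReal_mul, Complex.ofReal_re, Complex.I_re]
  ring

lemma airyG_cont (x : ℝ) : Continuous (airyG x) := by
  unfold airyG
  fun_prop

lemma airyG_diff (x : ℝ) : Differentiable ℂ (airyG x) := by
  unfold airyG
  fun_prop

lemma airy_bound (k : ℕ) (hk : k ≤ 2) (x t : ℝ) :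
    ‖((t : ℂ) + Complex.I) ^ k * airyG x ((t : ℂ) + Complex.I)‖
      ≤ 2 * Real.exp (1 / 3 - x) * Real.exp (-(1 / 2) * t ^ 2) := by
  have h1 := airyG_norm x t 1
  rw [Complex.ofReal_one, one_mul] at h1
  rw [norm_mul, h1, norm_pow]
  have h2 : ‖(t : ℂ) + Complex.I‖ ^ 2 = t ^ 2 + 1 := by
    rw [Complex.sq_norm, Complex.normSq_apply]
    simp
    ring
  have h3 : 1 ≤ ‖(t : ℂ) + Complex.I‖ := by
    by_contra! h
    nlinarith [norm_nonneg ((t : ℂ) + Complex.I), sq_nonneg t]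
  have h4 : ‖(t : ℂ) + Complex.I‖ ^ k ≤ 2 * Real.exp (t ^ 2 / 2) := by
    calc _ ≤ ‖(t : ℂ) + Complex.I‖ ^ 2 := pow_le_pow_right₀ h3 hk
      _ = t ^ 2 + 1 := h2
      _ ≤ _ := by
        have := Real.add_one_le_exp (t ^ 2 / 2)
        linarith
  calc _ ≤ 2 * Real.exp (t ^ 2 / 2) * Real.exp (-t ^ 2 * 1 + 1 ^ 3 / 3 - x * 1) := by gcongr
    _ = _ := by
      rw [mul_assoc, mul_assoc, ← Real.exp_add, ← Real.exp_add]
      congr 2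
      ring

lemma airy_cont (k : ℕ) (x : ℝ) :
    Continuous (fun t : ℝ => ((t : ℂ) + Complex.I) ^ k * airyG x ((t : ℂ) + Complex.I)) := by
  have := airyG_cont x
  fun_prop

lemma gauss_int (c : ℝ) : Integrable (fun t : ℝ => c * Real.exp (-(1 / 2) * t ^ 2)) :=
  (integrable_exp_neg_mul_sq (by norm_num)).const_mul c

lemma airy_integrable (k : ℕ) (hk : k ≤ 2) (x : ℝ) :
    Integrable (fun t : ℝ => ((t : ℂ) + Complex.I) ^ k * airyG x ((t : ℂ) + Complex.I)) :=
  (gauss_int (2 * Real.exp (1 / 3 - x))).mono' (airy_cont k x).aestronglyMeasurable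
    (Eventually.of_forall fun t => airy_bound k hk x t)

lemma airyF_tendsto (k : ℕ) (hk : k ≤ 2) (c : ℝ) :
    Tendsto (fun x => airyF k (x + c)) atTop (𝓝 0) := by
  have hb : ∀ x, ‖airyF k (x + c)‖ ≤ (∫ t : ℝ, Real.exp (-(1 / 2) * t ^ 2)) * 2 *
      Real.exp (1 / 3 - (x + c)) := by
    intro x
    calc _ ≤ ∫ t : ℝ, 2 * Real.exp (1 / 3 - (x + c)) * Real.exp (-(1 / 2) * t ^ 2) :=
          norm_integral_le_of_norm_le (gauss_int _)
            (Eventually.of_forall fun t => airy_bound k hk (x + c) t)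
      _ = _ := by rw [integral_const_mul]; ring
  refine squeeze_zero_norm hb ?_
  have : Tendsto (fun x : ℝ => 1 / 3 - (x + c)) atTop atBot := by
    have h := tendsto_neg_atTop_atBot.comp (tendsto_atTop_add_const_right atTop (c - 1 / 3)
      (tendsto_id (α := ℝ)))
    refine h.congr fun x => ?_
    simp
    ring
  have h2 := (Real.tendsto_exp_atBot.comp this).const_mul
    ((∫ t : ℝ, Real.exp (-(1 / 2) * t ^ 2)) * 2)
  rw [mul_zero] at h2
  exact h2

lemma airyF_deriv (k : ℕ) (hk : k + 1 ≤ 2) (x : ℝ) :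
    HasDerivAt (airyF k) (Complex.I * airyF (k + 1) x) x := by
  have h := hasDerivAt_integral_of_dominated_loc_of_deriv_le (μ := volume) (𝕜 := ℝ)
    (F := fun (x t : ℝ) => ((t : ℂ) + Complex.I) ^ k * airyG x ((t : ℂ) + Complex.I))
    (F' := fun (x t : ℝ) => Complex.I *
      (((t : ℂ) + Complex.I) ^ (k + 1) * airyG x ((t : ℂ) + Complex.I)))
    (x₀ := x) (s := Metric.ball x 1)
    (bound := fun t => 2 * Real.exp (1 / 3 - x + 1) * Real.exp (-(1 / 2) * t ^ 2))
    (Metric.ball_mem_nhds x one_pos)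
    (Eventually.of_forall fun y => (airy_cont k y).aestronglyMeasurable)
    (airy_integrable k (by omega) x)
    ((airy_integrable (k + 1) hk x).const_mul _).aestronglyMeasurable
    (Eventually.of_forall fun t y hy => by
      rw [norm_mul, Complex.norm_I, one_mul]
      refine (airy_bound (k + 1) hk y t).trans ?_
      have : x - 1 ≤ y := by
        rw [Metric.mem_ball, Real.dist_eq, abs_lt] at hy
        linarith [hy.1]
      gcongr
      linarith)
    (gauss_int _)
    (Eventually.of_forall fun t y _ => by
      have h1 : HasDerivAt (fun y : ℝ => Complex.I * (((t : ℂ) + Complex.I) ^ 3 / 3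
          + (y : ℂ) * ((t : ℂ) + Complex.I))) (Complex.I * (1 * ((t : ℂ) + Complex.I))) y :=
        (((Complex.ofRealCLM.hasDerivAt (x := y)).mul_const _).const_add _).const_mul _
      have h2 := (h1.cexp).const_mul (((t : ℂ) + Complex.I) ^ k)
      refine h2.congr_deriv ?_
      simp only [airyG]
      ring)
  have h2 := h.2
  rw [integral_const_mul] at h2
  exact h2

lemma airyF_ode (x : ℝ) : airyF 2 x = - x * airyF 0 x := by
  have hd : ∀ t : ℝ, HasDerivAt (fun t : ℝ => airyG x ((t : ℂ) + Complex.I))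
      (Complex.I * (((t : ℂ) + Complex.I) ^ 2 * airyG x ((t : ℂ) + Complex.I)
        + x * (((t : ℂ) + Complex.I) ^ 0 * airyG x ((t : ℂ) + Complex.I)))) t := by
    intro t
    have h0 : HasDerivAt (fun t : ℝ => (t : ℂ) + Complex.I) 1 t :=
      (Complex.ofRealCLM.hasDerivAt (x := t)).add_const _
    have h1 := ((((h0.pow 3).div_const 3).add (h0.const_mul (x : ℂ))).const_mul Complex.I).cexp
    refine h1.congr_deriv ?_
    simp only [airyG, Pi.add_apply, Pi.pow_apply]
    push_cast
    ring
  have hg : Tendsto (fun t : ℝ => Real.exp (-(1 / 2) * t ^ 2)) (cocompact ℝ) (𝓝 0) := by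
    refine Real.tendsto_exp_atBot.comp ?_
    have h1 : Tendsto (fun t : ℝ => ‖t‖ ^ 2) (cocompact ℝ) atTop :=
      (tendsto_pow_atTop two_ne_zero).comp tendsto_norm_cocompact_atTop
    have := h1.const_mul_atTop_of_neg (show (-(1/2) : ℝ) < 0 by norm_num)
    simpa using this
  have hg2 : Tendsto (fun t : ℝ => airyG x ((t : ℂ) + Complex.I)) (cocompact ℝ) (𝓝 0) := by
    refine squeeze_zero_norm (a := fun t => 2 * Real.exp (1 / 3 - x) * Real.exp (-(1 / 2) * t ^ 2))
      (fun t => by simpa using airy_bound 0 (by norm_num) x t) ?_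
    simpa using hg.const_mul (2 * Real.exp (1 / 3 - x))
  have i2 := airy_integrable 2 le_rfl x
  have i0 := airy_integrable 0 (by norm_num) x
  have h := integral_of_hasDerivAt_of_tendsto hd ((i2.add (i0.const_mul _)).const_mul _)
    (hg2.mono_left atBot_le_cocompact) (hg2.mono_left atTop_le_cocompact)
  rw [integral_const_mul, integral_add i2 (i0.const_mul _), integral_const_mul, sub_zero] at h
  have h' : airyF 2 x + x * airyF 0 x = 0 :=
    (mul_eq_zero.1 h).resolve_left Complex.I_ne_zero
  linear_combination h'

lemma airy_vert (x : ℝ) (r : ℝ → ℝ) (hr : ∀ R, r R ^ 2 = R ^ 2) :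
    Tendsto (fun R : ℝ => ∫ y in (0:ℝ)..1, airyG x ((r R : ℂ) + y * Complex.I)) atTop (𝓝 0) := by
  have h := intervalIntegral.tendsto_integral_filter_of_dominated_convergence (μ := volume)
    (a := 0) (b := 1) (l := atTop)
    (F := fun (R y : ℝ) => airyG x ((r R : ℂ) + y * Complex.I)) (f := fun _ => (0 : ℂ))
    (fun _ => Real.exp (1 / 3 + |x|))
    (Eventually.of_forall fun R => by
      have := airyG_cont x
      exact (Continuous.aestronglyMeasurable (by fun_prop)))
    (Eventually.of_forall fun R => Eventually.of_forall fun y hy => by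
      rw [uIoc_of_le zero_le_one] at hy
      rw [airyG_norm]
      gcongr
      have h1 : y ^ 3 ≤ 1 := pow_le_one₀ hy.1.le hy.2
      have h2 : - x * y ≤ |x| := by
        calc _ ≤ |x| * y := mul_le_mul_of_nonneg_right (neg_le_abs x) hy.1.le
          _ ≤ _ := mul_le_of_le_one_right (abs_nonneg x) hy.2
      have h3 : 0 ≤ r R ^ 2 * y := mul_nonneg (sq_nonneg _) hy.1.le
      linarith)
    (by simp)
    (Eventually.of_forall fun y hy => by
      rw [uIoc_of_le zero_le_one] at hy
      rw [tendsto_zero_iff_norm_tendsto_zero]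
      simp only [airyG_norm, hr]
      refine Real.tendsto_exp_atBot.comp ?_
      have h1 : Tendsto (fun R : ℝ => R ^ 2) atTop atTop := tendsto_pow_atTop two_ne_zero
      have h2 := h1.const_mul_atTop_of_neg (neg_lt_zero.2 hy.1)
      have h3 := tendsto_atBot_add_const_right atTop (y ^ 3 / 3 - x * y) h2
      refine h3.congr fun R => ?_
      ring)
  simpa using h

lemma airy_rect (x R : ℝ) :
    ((2 * ∫ t in (0:ℝ)..R, Real.cos (t ^ 3 / 3 + x * t) : ℝ) : ℂ)
      = (∫ t in (-R)..R, airyG x ((t : ℂ) + Complex.I))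
        - Complex.I * (∫ y in (0:ℝ)..1, airyG x ((R : ℂ) + y * Complex.I))
        + Complex.I * (∫ y in (0:ℝ)..1, airyG x (((-R : ℝ) : ℂ) + y * Complex.I)) := by
  have h := Complex.integral_boundary_rect_eq_zero_of_differentiableOn (airyG x)
    ((-R : ℝ) : ℂ) ((R : ℂ) + Complex.I) (airyG_diff x).differentiableOn
  simp only [Complex.ofReal_re, Complex.ofReal_im, Complex.add_re, Complex.add_im, Complex.I_re,
    Complex.I_im, add_zero, zero_add, Complex.ofReal_zero, zero_mul, Complex.ofReal_one, one_mul,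
    smul_eq_mul] at h
  have hc : Continuous (fun t : ℝ => airyG x (t : ℂ)) := by
    have := airyG_cont x
    fun_prop
  have e : (∫ t in (-R)..R, airyG x (t : ℂ))
      = ((2 * ∫ t in (0:ℝ)..R, Real.cos (t ^ 3 / 3 + x * t) : ℝ) : ℂ) := by
    have e1 : (∫ t in (-R)..0, airyG x (t : ℂ)) = ∫ t in (0:ℝ)..R, airyG x ((-t : ℝ) : ℂ) := by
      have := intervalIntegral.integral_comp_neg (a := 0) (b := R) (fun t : ℝ => airyG x (t : ℂ))
      rw [this, neg_zero]
    have hc2 : Continuous (fun t : ℝ => airyG x ((-t : ℝ) : ℂ)) := hc.comp continuous_neg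
    rw [← intervalIntegral.integral_add_adjacent_intervals (b := 0)
      (hc.intervalIntegrable _ _) (hc.intervalIntegrable _ _), e1,
      ← intervalIntegral.integral_add (hc2.intervalIntegrable _ _) (hc.intervalIntegrable _ _),
      ← intervalIntegral.integral_const_mul, ← intervalIntegral.integral_ofReal]
    refine intervalIntegral.integral_congr fun t _ => ?_
    simp only [airyG]
    push_cast
    rw [Complex.two_cos, add_comm]
    congr 2 <;> ring
  rw [← e]
  linear_combination h

lemma airy_eq (x : ℝ) : (Ai x : ℂ) = (1 / (2 * Real.pi) : ℝ) * airyF 0 x := by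
  have i0 := airy_integrable 0 (by norm_num) x
  simp only [pow_zero, one_mul] at i0
  have h1 : Tendsto (fun R : ℝ => ∫ t in (-R)..R, airyG x ((t : ℂ) + Complex.I)) atTop
      (𝓝 (airyF 0 x)) := by
    simpa [airyF] using intervalIntegral_tendsto_integral i0 tendsto_neg_atTop_atBot tendsto_id
  have h2 := (airy_vert x id (fun _ => rfl)).const_mul Complex.I
  have h3 := (airy_vert x (fun R => -R) (fun R => by ring)).const_mul Complex.I
  have h4 := (h1.sub h2).add h3
  simp only [mul_zero, sub_zero, add_zero, id] at h4
  have h5 := h4.congr fun R => (airy_rect x R).symm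
  have hre := (Complex.continuous_re.tendsto _).comp h5
  have him := (Complex.continuous_im.tendsto _).comp h5
  have hre' : Tendsto (fun R : ℝ => 2 * ∫ t in (0:ℝ)..R, Real.cos (t ^ 3 / 3 + x * t)) atTop
      (𝓝 (airyF 0 x).re) := hre.congr fun R => by simp only [Function.comp, Complex.ofReal_re]
  have him' : Tendsto (fun _ : ℝ => (0:ℝ)) atTop
      (𝓝 (airyF 0 x).im) := him.congr fun R => by simp only [Function.comp, Complex.ofReal_im]
  have him0 : (airyF 0 x).im = 0 := tendsto_nhds_unique him' tendsto_const_nhds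
  have hl := (hre'.const_mul (1 / 2)).congr fun R => by
    show _ = ∫ t in (0:ℝ)..R, Real.cos (t ^ 3 / 3 + x * t)
    ring
  have hA : Ai x = 1 / (2 * Real.pi) * (airyF 0 x).re := by
    rw [Ai, hl.limUnder_eq]
    field_simp
  rw [hA, Complex.ofReal_mul]
  congr 1
  apply Complex.ext <;> simp [him0]

/-- If `a` and `b` are two distinct (negative) zeros of `Ai`, then the translates `Ai(· + a)`
and `Ai(· + b)` are orthogonal in `L²(0,∞)`. -/
theorem airy_translates_orthogonal (a b : ℝ) (ha : a < 0) (hb : b < 0) (hab : a ≠ b)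
    (hza : Ai a = 0) (hzb : Ai b = 0) :
    (∫ x in Set.Ioi (0:ℝ), Ai (x + a) * Ai (x + b)) = 0 := by
  have hpi : (((1 / (2 * Real.pi) : ℝ)) : ℂ) ≠ 0 := by
    rw [Complex.ofReal_ne_zero]
    positivity
  have hz : ∀ c, Ai c = 0 → airyF 0 c = 0 := by
    intro c hc
    have := airy_eq c
    rw [hc, Complex.ofReal_zero] at this
    exact (mul_eq_zero.1 this.symm).resolve_left hpi
  have hFa := hz a hza
  have hFb := hz b hzb
  have key : (∫ x in Set.Ioi (0:ℝ), airyF 0 (x + a) * airyF 0 (x + b)) = 0 := by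
    by_cases hi : IntegrableOn (fun x => airyF 0 (x + a) * airyF 0 (x + b)) (Set.Ioi (0:ℝ))
    swap
    · exact integral_undef hi
    have d0 : ∀ c x, HasDerivAt (fun x => airyF 0 (x + c)) (Complex.I * airyF 1 (x + c)) x :=
      fun c x => (airyF_deriv 0 (by norm_num) (x + c)).comp_add_const x c
    have d1 : ∀ c x, HasDerivAt (fun x => airyF 1 (x + c)) (Complex.I * airyF 2 (x + c)) x :=
      fun c x => (airyF_deriv 1 (by norm_num) (x + c)).comp_add_const x c
    have hW : ∀ x : ℝ, HasDerivAt (fun x => airyF 0 (x + a) * airyF 1 (x + b)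
        - airyF 1 (x + a) * airyF 0 (x + b))
        ((Complex.I * (a - b)) * (airyF 0 (x + a) * airyF 0 (x + b))) x := by
      intro x
      refine (((d0 a x).mul (d1 b x)).sub ((d1 a x).mul (d0 b x))).congr_deriv ?_
      rw [airyF_ode, airyF_ode]
      push_cast
      ring
    have t0 : Tendsto (fun x => airyF 0 (x + a) * airyF 1 (x + b)
        - airyF 1 (x + a) * airyF 0 (x + b)) atTop (𝓝 0) := by
      simpa using ((airyF_tendsto 0 (by norm_num) a).mul (airyF_tendsto 1 (by norm_num) b)).sub
        ((airyF_tendsto 1 (by norm_num) a).mul (airyF_tendsto 0 (by norm_num) b))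
    have h := integral_Ioi_of_hasDerivAt_of_tendsto' (a := 0) (fun x _ => hW x)
      (hi.const_mul _) t0
    simp only [zero_add, hFa, hFb, zero_mul, mul_zero, sub_zero] at h
    rw [integral_const_mul] at h
    refine (mul_eq_zero.1 h).resolve_left (mul_ne_zero Complex.I_ne_zero ?_)
    rw [sub_ne_zero]
    exact_mod_cast hab
  rw [← Complex.ofReal_eq_zero, ← integral_complex_ofReal]
  have : ∀ x : ℝ, ((Ai (x + a) * Ai (x + b) : ℝ) : ℂ)
      = ((1 / (2 * Real.pi) : ℝ) : ℂ) ^ 2 * (airyF 0 (x + a) * airyF 0 (x + b)) := by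
    intro x
    rw [Complex.ofReal_mul, airy_eq, airy_eq]
    ring
  calc _ = ∫ x in Set.Ioi (0:ℝ),
        ((1 / (2 * Real.pi) : ℝ) : ℂ) ^ 2 * (airyF 0 (x + a) * airyF 0 (x + b)) :=
        integral_congr_ae (Eventually.of_forall this)
    _ = 0 := by rw [integral_const_mul, key, mul_zero]
end
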